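/- Let 𝒜 be a uniformly complete f-algebra and let p ∈ ℕ with p ≥ 2. If g ∈ 𝒜 is self-majorizing in 𝒜, then g^p is self-majorizing in the product algebra Π_p(𝒜). If, in addition, 𝒜 is semiprime, then the converse also holds: g is self-majorizing in 𝒜 if and only if g^p is self-majorizing in Π_p(𝒜). -/

import Mathlib

namespace FiniteElementsPaper

/-- Product of `p` factors `φ 0 * φ 1 * ⋯ * φ (p-1)` in a (possibly non-unital)
multiplicative structure; junk value `0` when `p = 0`. -/
def mulProd {A : Type*} [Mul A] [Zero A] : (p : ℕ) → (Fin p → A) → A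
  | 0, _ => 0
  | q + 1, φ => Fin.foldl q (fun acc i => acc * φ i.succ) (φ 0)

/-- `p`-th power `a^p` (junk value `0` for `p = 0`). -/
def mpow {A : Type*} [Mul A] [Zero A] (a : A) (p : ℕ) : A :=
  mulProd p (fun _ => a)

/-- The set `Π_p(𝒜)` of all `p`-fold products. -/
def piSet (A : Type*) [Mul A] [Zero A] (p : ℕ) : Set A :=
  {x | ∃ φ : Fin p → A, x = mulProd p φ}

variable {A : Type*} [Lattice A] [AddCommGroup A] [Module ℝ A]

/-- `z` is a majorant of `φ`: `z ≥ 0` and for every `x` there is `c > 0` with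
`|x| ⊓ n • |φ| ≤ c • z` for all `n`. -/
def IsMajorant (z φ : A) : Prop :=
  0 ≤ z ∧ ∀ x : A, ∃ c : ℝ, 0 < c ∧ ∀ n : ℕ, |x| ⊓ n • |φ| ≤ c • z

/-- `φ` is a finite element. -/
def IsFiniteElt (φ : A) : Prop := ∃ z : A, IsMajorant z φ

/-- `φ` is a totally finite element: it has a majorant which is itself finite. -/
def IsTotallyFiniteElt (φ : A) : Prop := ∃ z : A, IsMajorant z φ ∧ IsFiniteElt z

/-- `φ` is self-majorizing: `|φ|` is a majorant of `φ`. -/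
def IsSelfMajorizing (φ : A) : Prop := IsMajorant |φ| φ

/-- `φ ∈ Φ₃(A) = S₊(A) - S₊(A)`. -/
def InPhi3 (φ : A) : Prop :=
  ∃ s t : A, 0 ≤ s ∧ 0 ≤ t ∧ IsSelfMajorizing s ∧ IsSelfMajorizing t ∧ φ = s - t

/-- `w` is a majorant of `φ` relative to the subset `S` (all lattice operations
computed in the ambient algebra). -/
def IsMajorantIn (S : Set A) (w φ : A) : Prop :=
  0 ≤ w ∧ ∀ x ∈ S, ∃ c : ℝ, 0 < c ∧ ∀ n : ℕ, |x| ⊓ n • |φ| ≤ c • w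

/-- `φ` is a finite element of the sublattice `S` (majorant required to lie in `S`). -/
def IsFiniteEltIn (S : Set A) (φ : A) : Prop := ∃ w ∈ S, IsMajorantIn S w φ

/-- `φ` is a totally finite element of the sublattice `S`. -/
def IsTotallyFiniteEltIn (S : Set A) (φ : A) : Prop :=
  ∃ w ∈ S, IsMajorantIn S w φ ∧ IsFiniteEltIn S w

/-- `φ` is self-majorizing in the sublattice `S`. -/
def IsSelfMajorizingIn (S : Set A) (φ : A) : Prop := IsMajorantIn S |φ| φ

/-- `φ ∈ Φ₃(S) = S₊(S) - S₊(S)` for the sublattice `S`. -/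
def InPhi3In (S : Set A) (φ : A) : Prop :=
  ∃ s t : A, s ∈ S ∧ t ∈ S ∧ 0 ≤ s ∧ 0 ≤ t ∧
    IsSelfMajorizingIn S s ∧ IsSelfMajorizingIn S t ∧ φ = s - t

variable (A) in
/-- Archimedean ℓ-algebra structure: an Archimedean vector lattice together with an
associative bilinear multiplication whose product of positive elements is positive. -/
structure IsLAlgebra [Mul A] : Prop where
  add_le_add_left : ∀ a b : A, a ≤ b → ∀ c : A, c + a ≤ c + b
  smul_le_smul : ∀ (r : ℝ) (a b : A), 0 ≤ r → a ≤ b → r • a ≤ r • b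
  archimedean : ∀ a b : A, 0 ≤ a → (∀ n : ℕ, n • a ≤ b) → a = 0
  mul_assoc : ∀ a b c : A, a * b * c = a * (b * c)
  left_distrib : ∀ a b c : A, a * (b + c) = a * b + a * c
  right_distrib : ∀ a b c : A, (a + b) * c = a * c + b * c
  smul_mul : ∀ (r : ℝ) (a b : A), (r • a) * b = r • (a * b)
  mul_smul : ∀ (r : ℝ) (a b : A), a * (r • b) = r • (a * b)
  mul_nonneg : ∀ a b : A, 0 ≤ a → 0 ≤ b → 0 ≤ a * b

variable (A) in
/-- A `d`-algebra: ℓ-algebra in which `a ⊓ b = 0` implies `(a*c) ⊓ (b*c) = (c*a) ⊓ (c*b) = 0`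
for all `c ≥ 0`. -/
structure IsDAlgebra [Mul A] extends IsLAlgebra A : Prop where
  d_prop : ∀ a b c : A, a ⊓ b = 0 → 0 ≤ c → (a * c) ⊓ (b * c) = 0 ∧ (c * a) ⊓ (c * b) = 0

variable (A) in
/-- An `f`-algebra: ℓ-algebra in which `a ⊓ b = 0` implies `(a*c) ⊓ b = (c*a) ⊓ b = 0`
for all `c ≥ 0`. -/
structure IsFAlgebra [Mul A] extends IsLAlgebra A : Prop where
  f_prop : ∀ a b c : A, a ⊓ b = 0 → 0 ≤ c → (a * c) ⊓ b = 0 ∧ (c * a) ⊓ b = 0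

/-- `e` is a multiplicative unit. -/
def IsMulUnit [Mul A] (e : A) : Prop := ∀ a : A, a * e = a ∧ e * a = a

/-- `e` is an order unit. -/
def IsOrderUnit (e : A) : Prop := 0 ≤ e ∧ ∀ x : A, ∃ l : ℝ, 0 ≤ l ∧ |x| ≤ l • e

variable (A) in
/-- The algebra is semiprime: `0` is its only nilpotent element. -/
def IsSemiprime [Mul A] [Zero A] : Prop :=
  ∀ (a : A) (n : ℕ), 0 < n → mpow a n = 0 → a = 0

variable (A) in
/-- The vector lattice is uniformly complete. -/
def UniformlyComplete : Prop :=
  ∀ u : A, 0 ≤ u → ∀ f : ℕ → A,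
    (∀ ε : ℝ, 0 < ε → ∃ K : ℕ, ∀ m n : ℕ, K ≤ m → K ≤ n → |f m - f n| ≤ ε • u) →
    ∃ a : A, ∀ ε : ℝ, 0 < ε → ∃ K : ℕ, ∀ n : ℕ, K ≤ n → |f n - a| ≤ ε • u

variable (A) in
/-- The weak factorization property: every element is dominated by a product. -/
def WeakFactorization [Mul A] : Prop := ∀ a : A, ∃ b c : A, a ≤ b * c


section

/-! ### Lattice-ordered groups -/

lemma add_inf_eq_zero {G : Type*} [Lattice G] [AddCommGroup G] [IsOrderedAddMonoid G]
    {x y z : G} (hx : 0 ≤ x) (hy : 0 ≤ y)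
    (hxz : x ⊓ z = 0) (hyz : y ⊓ z = 0) : (x + y) ⊓ z = 0 := by
  have hz : 0 ≤ z := hxz.symm.le.trans inf_le_right
  have hle : (x + y) ⊓ z ≤ y := by
    have h : (x + y) ⊓ z - y ≤ x ⊓ z :=
      le_inf (sub_le_iff_le_add.2 inf_le_left) ((sub_le_self _ hy).trans inf_le_right)
    rwa [hxz, sub_nonpos] at h
  exact le_antisymm ((le_inf hle inf_le_right).trans hyz.le) (le_inf (add_nonneg hx hy) hz)

lemma abs_sub_of_inf_eq_zero {G : Type*} [Lattice G] [AddCommGroup G] [IsOrderedAddMonoid G]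
    {x y : G} (h : x ⊓ y = 0) :
    |x - y| = x + y := by
  rw [← sup_sub_inf_eq_abs_sub, sup_comm, inf_comm, h, sub_zero, ← inf_add_sup x y, h, zero_add]

lemma sub_inf_inf_sub_inf {G : Type*} [Lattice G] [AddCommGroup G] [IsOrderedAddMonoid G]
    (a b : G) :
    (a - a ⊓ b) ⊓ (b - a ⊓ b) = 0 := by
  rw [sub_eq_add_neg, sub_eq_add_neg, ← inf_add, ← sub_eq_add_neg, sub_self]

/-! ### Products -/

lemma mulProd_succ_last {A : Type*} [Mul A] [Zero A] (q : ℕ) (φ : Fin (q + 2) → A) :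
    mulProd (q + 2) φ = mulProd (q + 1) (fun i => φ i.castSucc) * φ (Fin.last (q + 1)) := by
  simp [mulProd, Fin.foldl_succ_last]

lemma mpow_one {A : Type*} [Mul A] [Zero A] (a : A) : mpow a 1 = a := by
  simp [mpow, mulProd]

lemma mpow_succ {A : Type*} [Mul A] [Zero A] (a : A) (q : ℕ) :
    mpow a (q + 2) = mpow a (q + 1) * a :=
  mulProd_succ_last q _

lemma mpow_mem_piSet {A : Type*} [Mul A] [Zero A] (a : A) (p : ℕ) : mpow a p ∈ piSet A p :=
  ⟨_, rfl⟩

variable [Mul A]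

lemma IsLAlgebra.isOrderedAddMonoid (hA : IsLAlgebra A) : IsOrderedAddMonoid A where
  add_le_add_left a b h c := by
    simpa only [add_comm _ c] using hA.add_le_add_left a b h c

lemma IsLAlgebra.mul_le_mul [IsOrderedAddMonoid A] (hA : IsLAlgebra A) {a b c d : A}
    (ha : 0 ≤ a) (hab : a ≤ b) (hc : 0 ≤ c) (hcd : c ≤ d) : a * c ≤ b * d := by
  have h₁ : b * c = a * c + (b - a) * c := by rw [← hA.right_distrib, add_sub_cancel]
  have h₂ : b * d = b * c + b * (d - c) := by rw [← hA.left_distrib, add_sub_cancel]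
  rw [h₂, h₁, add_assoc]
  exact le_add_of_nonneg_right (add_nonneg (hA.mul_nonneg _ _ (sub_nonneg.2 hab) hc)
    (hA.mul_nonneg _ _ (ha.trans hab) (sub_nonneg.2 hcd)))

lemma IsLAlgebra.smul_nonneg (hA : IsLAlgebra A) {r : ℝ} {a : A} (hr : 0 ≤ r) (ha : 0 ≤ a) :
    0 ≤ r • a := by
  simpa using hA.smul_le_smul r 0 a hr ha

lemma IsLAlgebra.smul_le_smul_right [IsOrderedAddMonoid A] (hA : IsLAlgebra A) {r s : ℝ} {a : A}
    (hrs : r ≤ s) (ha : 0 ≤ a) : r • a ≤ s • a := by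
  rw [← sub_nonneg, ← sub_smul]
  exact hA.smul_nonneg (sub_nonneg.2 hrs) ha

lemma IsLAlgebra.mulProd_nonneg (hA : IsLAlgebra A) (q : ℕ) (φ : Fin (q + 1) → A)
    (hφ : ∀ i, 0 ≤ φ i) : 0 ≤ mulProd (q + 1) φ := by
  induction q with
  | zero => simpa [mulProd] using hφ 0
  | succ q ih =>
    rw [mulProd_succ_last]
    exact hA.mul_nonneg _ _ (ih _ fun i => hφ _) (hφ _)

lemma IsLAlgebra.mpow_nonneg (hA : IsLAlgebra A) (q : ℕ) {a : A} (ha : 0 ≤ a) :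
    0 ≤ mpow a (q + 1) :=
  hA.mulProd_nonneg q _ fun _ => ha

lemma IsLAlgebra.mulProd_le_mulProd [IsOrderedAddMonoid A] (hA : IsLAlgebra A) (q : ℕ)
    (φ ψ : Fin (q + 1) → A) (hφ : ∀ i, 0 ≤ φ i) (hle : ∀ i, φ i ≤ ψ i) :
    mulProd (q + 1) φ ≤ mulProd (q + 1) ψ := by
  induction q with
  | zero => simpa [mulProd] using hle 0
  | succ q ih =>
    rw [mulProd_succ_last, mulProd_succ_last]
    exact hA.mul_le_mul (hA.mulProd_nonneg q _ fun i => hφ _)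
      (ih _ _ (fun i => hφ _) fun i => hle _) (hφ _) (hle _)

lemma IsLAlgebra.mpow_le_mpow [IsOrderedAddMonoid A] (hA : IsLAlgebra A) (q : ℕ) {a b : A}
    (ha : 0 ≤ a) (hab : a ≤ b) : mpow a (q + 1) ≤ mpow b (q + 1) :=
  hA.mulProd_le_mulProd q _ _ (fun _ => ha) fun _ => hab

lemma IsLAlgebra.mpow_smul (hA : IsLAlgebra A) (q : ℕ) (r : ℝ) (a : A) :
    mpow (r • a) (q + 1) = r ^ (q + 1) • mpow a (q + 1) := by
  induction q with
  | zero => simp [mpow_one]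
  | succ q ih =>
    rw [mpow_succ, mpow_succ, ih, hA.smul_mul, hA.mul_smul, smul_smul, ← pow_succ]

/-! ### `f`-algebras -/

lemma IsFAlgebra.abs_mul [IsOrderedAddMonoid A] (hA : IsFAlgebra A) (a b : A) :
    |a * b| = |a| * |b| := by
  have mul_inf {x y c : A} (hc : 0 ≤ c) (h : x ⊓ y = 0) : (x * c) ⊓ y = 0 :=
    (hA.f_prop x y c h hc).1
  have inf_mul {x y c : A} (hc : 0 ≤ c) (h : x ⊓ y = 0) : (c * x) ⊓ y = 0 :=
    (hA.f_prop x y c h hc).2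
  have ha := posPart_inf_negPart_eq_zero a
  have hb := posPart_inf_negPart_eq_zero b
  have ha' : a⁻ ⊓ a⁺ = 0 := by rwa [inf_comm]
  have hb' : b⁻ ⊓ b⁺ = 0 := by rwa [inf_comm]
  have hap := posPart_nonneg a
  have han := negPart_nonneg a
  have hbp := posPart_nonneg b
  have hbn := negPart_nonneg b
  have hdecomp : a * b = (a⁺ * b⁺ + a⁻ * b⁻) - (a⁺ * b⁻ + a⁻ * b⁺) := by
    have h₁ : a * b + a⁻ * b = a⁺ * b := by
      rw [← hA.right_distrib, ← sub_eq_iff_eq_add.1 (posPart_sub_negPart a)]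
    have h₂ : a⁺ * b + a⁺ * b⁻ = a⁺ * b⁺ := by
      rw [← hA.left_distrib, ← sub_eq_iff_eq_add.1 (posPart_sub_negPart b)]
    have h₃ : a⁻ * b + a⁻ * b⁻ = a⁻ * b⁺ := by
      rw [← hA.left_distrib, ← sub_eq_iff_eq_add.1 (posPart_sub_negPart b)]
    rw [← h₂, ← h₃, ← h₁]
    abel
  have hdisj : (a⁺ * b⁺ + a⁻ * b⁻) ⊓ (a⁺ * b⁻ + a⁻ * b⁺) = 0 := by
    have key {x y z w c d : A} (hx : 0 ≤ x) (hy : 0 ≤ y) (hz : 0 ≤ z) (hw : 0 ≤ w)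
        (h : x ⊓ y = 0 ∨ z ⊓ w = 0) : (x * z) ⊓ (y * w) = 0 := by
      rcases h with h | h
      · refine mul_inf hz ?_
        rw [inf_comm] at h ⊢
        exact mul_inf hw h
      · refine inf_mul hx ?_
        rw [inf_comm] at h ⊢
        exact inf_mul hy h
    have mn := hA.mul_nonneg
    refine add_inf_eq_zero (mn _ _ hap hbp) (mn _ _ han hbn) ?_ ?_ <;> rw [inf_comm] <;>
      refine add_inf_eq_zero (mn _ _ hap hbn) (mn _ _ han hbp) ?_ ?_ <;>
      apply key <;> first | assumption | exact .inl ‹_› | exact .inr ‹_›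
  rw [hdecomp, abs_sub_of_inf_eq_zero hdisj, ← posPart_add_negPart a, ← posPart_add_negPart b,
    hA.right_distrib, hA.left_distrib, hA.left_distrib]
  abel

lemma IsFAlgebra.abs_mulProd [IsOrderedAddMonoid A] (hA : IsFAlgebra A) (q : ℕ)
    (φ : Fin (q + 1) → A) : |mulProd (q + 1) φ| = mulProd (q + 1) fun i => |φ i| := by
  induction q with
  | zero => simp [mulProd]
  | succ q ih => rw [mulProd_succ_last, mulProd_succ_last, hA.abs_mul, ih]

lemma IsFAlgebra.abs_mpow [IsOrderedAddMonoid A] (hA : IsFAlgebra A) (q : ℕ) (a : A) :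
    |mpow a (q + 1)| = mpow |a| (q + 1) :=
  hA.abs_mulProd q _

/-- The powers of `a` and `b` differ from the power of `a ⊓ b` by disjoint positive elements. -/
lemma IsFAlgebra.exists_mpow_eq_mpow_inf_add [IsOrderedAddMonoid A] (hA : IsFAlgebra A) (q : ℕ)
    {a b : A} (ha : 0 ≤ a) (hb : 0 ≤ b) :
    ∃ u v : A, 0 ≤ u ∧ 0 ≤ v ∧ mpow a (q + 1) = mpow (a ⊓ b) (q + 1) + u ∧
      mpow b (q + 1) = mpow (a ⊓ b) (q + 1) + v ∧ u ⊓ v = 0 ∧ u ⊓ (b - a ⊓ b) = 0 ∧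
      v ⊓ (a - a ⊓ b) = 0 ∧ mpow (a - a ⊓ b) (q + 1) ≤ u := by
  have mul_inf {x y c : A} (hc : 0 ≤ c) (h : x ⊓ y = 0) : (x * c) ⊓ y = 0 :=
    (hA.f_prop x y c h hc).1
  have inf_mul {x y c : A} (hc : 0 ≤ c) (h : x ⊓ y = 0) : (c * x) ⊓ y = 0 :=
    (hA.f_prop x y c h hc).2
  have hm : 0 ≤ a ⊓ b := le_inf ha hb
  have ha' : 0 ≤ a - a ⊓ b := sub_nonneg.2 inf_le_left
  have hb' : 0 ≤ b - a ⊓ b := sub_nonneg.2 inf_le_right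
  have hab := sub_inf_inf_sub_inf a b
  have ham : a = a ⊓ b + (a - a ⊓ b) := by abel
  have hbm : b = a ⊓ b + (b - a ⊓ b) := by abel
  generalize a - a ⊓ b = a' at *
  generalize b - a ⊓ b = b' at *
  generalize a ⊓ b = m at *
  subst ham hbm
  have hba : b' ⊓ a' = 0 := by rwa [inf_comm]
  have mn := hA.mul_nonneg
  induction q with
  | zero => exact ⟨a', b', by simp [mpow_one, *]⟩
  | succ q ih =>
    obtain ⟨u, v, hu, hv, hau, hbv, huv, hub, hva, hle⟩ := ih
    have hk := hA.mpow_nonneg q hm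
    have expand {x y z w : A} : (x + y) * (z + w) = x * z + (y * z + (y * w + x * w)) := by
      rw [hA.right_distrib, hA.left_distrib, hA.left_distrib]
      abel
    have disj {y w z : A} (hy : 0 ≤ y) (hw : 0 ≤ w) (hyz : y ⊓ z = 0) (hwz : w ⊓ z = 0) :
        (y * m + (y * w + mpow m (q + 1) * w)) ⊓ z = 0 :=
      add_inf_eq_zero (mn _ _ hy hm) (add_nonneg (mn _ _ hy hw) (mn _ _ hk hw))
        (mul_inf hm hyz) (add_inf_eq_zero (mn _ _ hy hw) (mn _ _ hk hw)
          (mul_inf hw hyz) (inf_mul hk hwz))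
    have nonneg {y w : A} (hy : 0 ≤ y) (hw : 0 ≤ w) :
        0 ≤ y * m + (y * w + mpow m (q + 1) * w) :=
      add_nonneg (mn _ _ hy hm) (add_nonneg (mn _ _ hy hw) (mn _ _ hk hw))
    have hub' := disj hu ha' hub hab
    have hva' := disj hv hb' hva hba
    have huv' := disj hu ha' huv (by rwa [inf_comm])
    refine ⟨_, _, nonneg hu ha', nonneg hv hb', ?_, ?_, ?_, hub', hva', ?_⟩
    · rw [mpow_succ, mpow_succ, hau, expand]
    · rw [mpow_succ, mpow_succ, hbv, expand]
    · rw [inf_comm] at hub' huv' ⊢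
      exact disj hv hb' huv' hub'
    · rw [mpow_succ]
      calc mpow a' (q + 1) * a' ≤ u * a' :=
            hA.mul_le_mul (hA.mpow_nonneg q ha') hle ha' le_rfl
        _ ≤ u * a' + mpow m (q + 1) * a' := le_add_of_nonneg_right (mn _ _ hk ha')
        _ ≤ _ := le_add_of_nonneg_left (mn _ _ hu hm)

lemma IsFAlgebra.mpow_inf [IsOrderedAddMonoid A] (hA : IsFAlgebra A) (q : ℕ) {a b : A}
    (ha : 0 ≤ a) (hb : 0 ≤ b) :
    mpow (a ⊓ b) (q + 1) = mpow a (q + 1) ⊓ mpow b (q + 1) := by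
  obtain ⟨u, v, -, -, hau, hbv, huv, -⟩ := hA.exists_mpow_eq_mpow_inf_add q ha hb
  rw [hau, hbv, ← add_inf, huv, add_zero]

lemma IsFAlgebra.le_of_mpow_le_mpow [IsOrderedAddMonoid A] (hA : IsFAlgebra A)
    (hs : IsSemiprime A) (q : ℕ) {a b : A} (ha : 0 ≤ a) (hb : 0 ≤ b)
    (h : mpow a (q + 1) ≤ mpow b (q + 1)) : a ≤ b := by
  obtain ⟨u, v, -, -, hau, hbv, huv, -, -, hle⟩ := hA.exists_mpow_eq_mpow_inf_add q ha hb
  rw [hau, hbv, add_le_add_iff_left] at h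
  rw [inf_eq_left.2 h] at huv
  have ha' : 0 ≤ a - a ⊓ b := sub_nonneg.2 inf_le_left
  have hz := hs _ _ q.succ_pos (le_antisymm (hle.trans huv.le) (hA.mpow_nonneg q ha'))
  exact inf_eq_left.1 (sub_eq_zero.1 hz).symm

lemma IsFAlgebra.isSelfMajorizingIn_mpow [IsOrderedAddMonoid A] (hA : IsFAlgebra A) (q : ℕ)
    {g : A} (hg : IsSelfMajorizing g) :
    IsSelfMajorizingIn (piSet A (q + 1)) (mpow g (q + 1)) := by
  refine ⟨abs_nonneg _, ?_⟩
  rintro x ⟨φ, rfl⟩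
  rw [hA.abs_mpow, hA.abs_mulProd]
  have ha : 0 ≤ ∑ i, |φ i| := Finset.sum_nonneg fun i _ => abs_nonneg _
  obtain ⟨c, hc, hle⟩ := hg.2 (∑ i, |φ i|)
  rw [abs_of_nonneg ha] at hle
  refine ⟨c ^ (q + 1), by positivity, fun n => ?_⟩
  have hgn : 0 ≤ n • |g| := nsmul_nonneg (abs_nonneg g) n
  rw [← hA.mpow_smul]
  refine le_trans ?_ (hA.mpow_le_mpow q (le_inf ha hgn) (hle n))
  rw [hA.mpow_inf q ha hgn, ← Nat.cast_smul_eq_nsmul ℝ n |g|, hA.mpow_smul, ← Nat.cast_pow,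
    Nat.cast_smul_eq_nsmul]
  refine inf_le_inf (hA.mulProd_le_mulProd q _ _ (fun i => abs_nonneg _) fun i =>
    Finset.single_le_sum (f := fun i => |φ i|) (fun i _ => abs_nonneg _) (Finset.mem_univ i)) ?_
  exact nsmul_le_nsmul_left (hA.mpow_nonneg q (abs_nonneg g)) (Nat.le_self_pow q.succ_ne_zero n)

lemma IsFAlgebra.isSelfMajorizing_of_mpow [IsOrderedAddMonoid A] (hA : IsFAlgebra A)
    (hs : IsSemiprime A) (q : ℕ) {g : A}
    (hg : IsSelfMajorizingIn (piSet A (q + 1)) (mpow g (q + 1))) : IsSelfMajorizing g := by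
  refine ⟨abs_nonneg _, fun x => ?_⟩
  obtain ⟨c, hc, hle⟩ := hg.2 _ (mpow_mem_piSet x (q + 1))
  rw [hA.abs_mpow, hA.abs_mpow] at hle
  have hpos : 0 < max c 1 := lt_max_of_lt_left hc
  refine ⟨max c 1, hpos, fun n => ?_⟩
  have hgn : 0 ≤ n • |g| := nsmul_nonneg (abs_nonneg g) n
  refine hA.le_of_mpow_le_mpow hs q (le_inf (abs_nonneg x) hgn)
    (hA.smul_nonneg hpos.le (abs_nonneg g)) ?_
  have hn := hle (n ^ (q + 1))
  rw [← Nat.cast_smul_eq_nsmul ℝ, Nat.cast_pow, ← hA.mpow_smul, Nat.cast_smul_eq_nsmul,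
    ← hA.mpow_inf q (abs_nonneg x) hgn] at hn
  rw [hA.mpow_smul]
  refine hn.trans (hA.smul_le_smul_right ?_ (hA.mpow_nonneg q (abs_nonneg g)))
  exact (le_max_left c 1).trans (le_self_pow₀ (le_max_right c 1) q.succ_ne_zero)

end

/-- In a uniformly complete f-algebra, `g` self-majorizing in `𝒜` implies `g^p`
self-majorizing in `Π_p(𝒜)`; if moreover the algebra is semiprime, the converse holds as
well. -/
theorem stmt18 {A : Type*} [Lattice A] [AddCommGroup A] [Module ℝ A] [Mul A]
    (hA : IsFAlgebra A) (huc : UniformlyComplete A) (p : ℕ) (hp : 2 ≤ p) :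
    (∀ g : A, IsSelfMajorizing g → IsSelfMajorizingIn (piSet A p) (mpow g p)) ∧
    (IsSemiprime A →
      ∀ g : A, IsSelfMajorizing g ↔ IsSelfMajorizingIn (piSet A p) (mpow g p)) := by
  have := hA.isOrderedAddMonoid
  obtain ⟨q, rfl⟩ : ∃ q, p = q + 1 := ⟨p - 1, by omega⟩
  exact ⟨fun g => hA.isSelfMajorizingIn_mpow q, fun hs g =>
    ⟨hA.isSelfMajorizingIn_mpow q, hA.isSelfMajorizing_of_mpow hs q⟩⟩

end FiniteElementsPaper
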